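/- arXiv:2504.02611 — 3 statements merged into one kernel-verified Lean document; each statement's English description precedes it below -/
import Mathlib

section
/- Let F be a family of regions in ℝ², let X ⊆ F be a witness, let P ∼ F be a realisation, and let A ⊆ F with A ∩ X = ∅. Then the family F ⊙_P A obtained from F by replacing each R_i ∈ A with the point region {p_i} is not finished. Consequently, every subset A ⊆ F for which F ⊙_P A is finished contains at least one region of every witness of F. -/
open scoped Classical
open Pointwise Set Metric

noncomputable section

/-- The plane ℝ². -/
abbrev Plane : Type := EuclideanSpace ℝ (Fin 2)

/-- The closed convex cone C = {(x, y) : y ≤ −|x|} generated by (−1,−1) and (1,−1). -/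
def quarterCone : Set Plane := {p : Plane | p 1 ≤ -|p 0|}

/-- Upper quarter convex hull of a set of points: the frontier of convexHull(S) + C. -/
def CHpts (S : Set Plane) : Set Plane := frontier (convexHull ℝ S + quarterCone)

/-- Upper quarter outer convex hull of a family of regions. -/
def OCH {n : ℕ} (F : Fin n → Set Plane) : Set Plane :=
  frontier (convexHull ℝ (⋃ i, F i) + quarterCone)

/-- A point region is a singleton. -/
def IsPointRegion (R : Set Plane) : Prop := ∃ p : Plane, R = {p}

/-- A region is either a point region, or a compact connected set equal to the
closure of its nonempty interior. -/
def IsRegion (R : Set Plane) : Prop :=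
  IsPointRegion R ∨
    (IsCompact R ∧ IsConnected R ∧ (interior R).Nonempty ∧ R = closure (interior R))

/-- A family of regions. -/
def RegionFamily {n : ℕ} (F : Fin n → Set Plane) : Prop := ∀ i, IsRegion (F i)

/-- The partial order ≺_P on indices induced by the left-to-right traversal of CH(P). -/
def precOrder {n : ℕ} (P : Fin n → Plane) (a b : Fin n) : Prop :=
  P a ∈ CHpts (Set.range P) ∧ P b ∈ CHpts (Set.range P) ∧ P a 0 < P b 0

/-- A family is finished if all realisations induce the same partial order. -/
def Finished {n : ℕ} (F : Fin n → Set Plane) : Prop :=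
  ∀ P₁ P₂ : Fin n → Plane, (∀ i, P₁ i ∈ F i) → (∀ i, P₂ i ∈ F i) →
    precOrder P₁ = precOrder P₂

/-- X is a witness: for every choice of points q_i ∈ R_i for regions outside X,
replacing each region outside X by the corresponding point yields an unfinished family. -/
def IsWitness {n : ℕ} (F : Fin n → Set Plane) (X : Set (Fin n)) : Prop :=
  ∀ q : Fin n → Plane, (∀ i, i ∉ X → q i ∈ F i) →
    ¬ Finished (fun i => if i ∈ X then F i else {q i})

/-- p is a vertex of R: p lies on the frontier of R and every (nondegenerate) open
segment containing p contains a point off the frontier of R. -/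
def IsVertex (R : Set Plane) (p : Plane) : Prop :=
  p ∈ frontier R ∧ ∀ q r : Plane, q ≠ r → p ∈ openSegment ℝ q r →
    ∃ z ∈ openSegment ℝ q r, z ∉ frontier R

/-- p is a vertex of some region of the family F. -/
def FamVertex {n : ℕ} (F : Fin n → Set Plane) (p : Plane) : Prop := ∃ i, IsVertex (F i) p

/-- (s, t) is an edge of OCH(F): distinct vertices of V(F), the closed segment [s,t]
lies on OCH(F), and its relative interior contains no point of V(F). -/
def IsEdge {n : ℕ} (F : Fin n → Set Plane) (s t : Plane) : Prop :=
  s ≠ t ∧ FamVertex F s ∧ FamVertex F t ∧ segment ℝ s t ⊆ OCH F ∧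
    ∀ p ∈ openSegment ℝ s t, ¬ FamVertex F p

/-- Two regions are strictly vertically separated. -/
def VertSep (R₁ R₂ : Set Plane) : Prop :=
  ∃ x₀ : ℝ, ((∀ p ∈ R₁, p 0 < x₀) ∧ (∀ p ∈ R₂, x₀ < p 0)) ∨
            ((∀ p ∈ R₂, p 0 < x₀) ∧ (∀ p ∈ R₁, x₀ < p 0))

/-- A vertex x is canonical in F: it is exclusively a vertex of point regions, or a
vertex of exactly one non-point region. -/
def CanonicalVertex {n : ℕ} (F : Fin n → Set Plane) (x : Plane) : Prop :=
  (∀ i, IsVertex (F i) x → IsPointRegion (F i)) ∨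
    (∃! i, IsVertex (F i) x ∧ ¬ IsPointRegion (F i))

/-- The pair (s, t) is canonical in F. -/
def CanonicalPair {n : ℕ} (F : Fin n → Set Plane) (s t : Plane) : Prop :=
  CanonicalVertex F s ∧ CanonicalVertex F t

/-- band(R₁, R₂) = convexHull(R₁ ∪ R₂). -/
def band (R₁ R₂ : Set Plane) : Set Plane := convexHull ℝ (R₁ ∪ R₂)

/-- (s, t) with s ∈ V(R_a), t ∈ V(R_b) is dividing: canonical, and a = b or the two
regions are strictly vertically separated. -/
def DividingPair {n : ℕ} (F : Fin n → Set Plane) (a b : Fin n) (s t : Plane) : Prop :=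
  IsVertex (F a) s ∧ IsVertex (F b) t ∧ CanonicalPair F s t ∧
    (a = b ∨ VertSep (F a) (F b))

/-- (s, t) is dividing for some pair of regions. -/
def DividingEdge {n : ℕ} (F : Fin n → Set Plane) (s t : Plane) : Prop :=
  ∃ a b, DividingPair F a b s t

/-- (s, t) is occupied: dividing, and band(R_a, R_b) contains a vertex of
V(F − R_a − R_b) other than s and t. -/
def OccupiedEdge {n : ℕ} (F : Fin n → Set Plane) (s t : Plane) : Prop :=
  ∃ a b, DividingPair F a b s t ∧
    ∃ i, i ≠ a ∧ i ≠ b ∧ ∃ q, IsVertex (F i) q ∧ q ∈ band (F a) (F b) ∧ q ≠ s ∧ q ≠ t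

/-- A contiguous subchain w = (q, r, …, s, t) of OCH(F) (of m ≥ 2 edges) that is
spanning in F for the regions (R_a, R_b, R_c). -/
def SpanningSubchain {n : ℕ} (F : Fin n → Set Plane) (m : ℕ) (w : Fin (m + 1) → Plane)
    (a b c : Fin n) : Prop :=
  2 ≤ m ∧
  (∀ j : Fin m, IsEdge F (w j.castSucc) (w j.succ)) ∧
  (∀ j : Fin m, DividingEdge F (w j.castSucc) (w j.succ)) ∧
  IsVertex (F a) (w 0) ∧ IsVertex (F c) (w (Fin.last m)) ∧
  (∀ j : Fin (m + 1), 1 ≤ (j : ℕ) → (j : ℕ) ≤ m - 1 → IsVertex (F b) (w j)) ∧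
  (F b ∩ interior (convexHull ℝ (F a ∪ F c) + quarterCone)).Nonempty

/-- F is terminal: every edge of OCH(F) is dividing, no edge is occupied, and no
contiguous subchain of OCH(F) is spanning. -/
def Terminal {n : ℕ} (F : Fin n → Set Plane) : Prop :=
  (∀ s t, IsEdge F s t → DividingEdge F s t) ∧
  (∀ s t, IsEdge F s t → ¬ OccupiedEdge F s t) ∧
  ¬ ∃ (m : ℕ) (w : Fin (m + 1) → Plane) (a b c : Fin n), SpanningSubchain F m w a b c

/-- A region appears on OCH(F) if some point of it lies on OCH(F). -/
def Appears {n : ℕ} (F : Fin n → Set Plane) (R : Set Plane) : Prop :=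
  ∃ p ∈ R, p ∈ OCH F

/-- The family F ⊙_P A obtained from F by retrieving the regions in A. -/
def retrieve {n : ℕ} (F : Fin n → Set Plane) (P : Fin n → Plane) (A : Set (Fin n)) :
    Fin n → Set Plane := fun i => if i ∈ A then {P i} else F i

/-- A family whose regions are contained in those of a finished family is finished. -/
theorem Finished.mono {n : ℕ} {F G : Fin n → Set Plane} (hF : Finished F)
    (hGF : ∀ i, G i ⊆ F i) : Finished G :=
  fun P₁ P₂ h₁ h₂ => hF P₁ P₂ (fun i => hGF i (h₁ i)) (fun i => hGF i (h₂ i))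

/-- Retrieving regions disjoint from a witness leaves the family unfinished. -/
theorem IsWitness.not_finished_retrieve {n : ℕ} {F : Fin n → Set Plane} {X : Set (Fin n)}
    (hX : IsWitness F X) {P : Fin n → Plane} (hP : ∀ i, P i ∈ F i) {A : Set (Fin n)}
    (hA : A ∩ X = ∅) : ¬ Finished (retrieve F P A) := by
  refine fun hfin => hX P (fun i _ => hP i) (hfin.mono fun i => ?_)
  by_cases hiX : i ∈ X
  · have hiA : i ∉ A := fun hiA => Set.eq_empty_iff_forall_notMem.mp hA i ⟨hiA, hiX⟩
    simp [retrieve, hiX, hiA]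
  · by_cases hiA : i ∈ A <;> simp [retrieve, hiX, hiA, hP i]

/-- If X is a witness, then retrieving a set A disjoint from X leaves the
family unfinished; consequently any A with F ⊙_P A finished meets every witness. -/
theorem witness_lower_bound {n : ℕ} (F : Fin n → Set Plane) (hF : RegionFamily F)
    (X : Set (Fin n)) (hX : IsWitness F X)
    (P : Fin n → Plane) (hP : ∀ i, P i ∈ F i) :
    (∀ A : Set (Fin n), A ∩ X = ∅ → ¬ Finished (retrieve F P A)) ∧
    (∀ A : Set (Fin n), Finished (retrieve F P A) → (A ∩ X).Nonempty) := by
  exact ⟨fun _ hA => hX.not_finished_retrieve hP hA, fun _ hfin =>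
    Set.nonempty_iff_ne_empty.mpr fun hA => hX.not_finished_retrieve hP hA hfin⟩
end
end

section
/- There is an absolute constant c > 0 such that the following holds. Let k ≥ 1, let F be a family of pairwise disjoint closed disks in ℝ² with radii in [1, k], let A ⊆ F, and for each R ∈ A choose a point p_R ∈ R; let F ⊙ A denote the family obtained from F by replacing each R ∈ A with the point region {p_R}. Let S be a vertical slab of width 2k and let F' = { R ∈ F ⊙ A : R ⊆ S }. Then the upper quarter outer convex hull OCH(F') has at most c·k edges; in particular, at most c·k distinct regions of F' appear on OCH(F'). -/
open scoped Classical
open Pointwise Set Metric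

noncomputable section

/-- Upper quarter outer convex hull of the subfamily of G indexed by I. -/
def OCHOn {n : ℕ} (G : Fin n → Set Plane) (I : Set (Fin n)) : Set Plane :=
  frontier (convexHull ℝ (⋃ i ∈ I, G i) + quarterCone)

/-- p is a vertex of some region of the subfamily of G indexed by I. -/
def FamVertexOn {n : ℕ} (G : Fin n → Set Plane) (I : Set (Fin n)) (p : Plane) : Prop :=
  ∃ i ∈ I, IsVertex (G i) p

/-- (s, t) is an edge of the outer hull of the subfamily of G indexed by I. -/
def IsEdgeOn {n : ℕ} (G : Fin n → Set Plane) (I : Set (Fin n)) (s t : Plane) : Prop :=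
  s ≠ t ∧ FamVertexOn G I s ∧ FamVertexOn G I t ∧ segment ℝ s t ⊆ OCHOn G I ∧
    ∀ p ∈ openSegment ℝ s t, ¬ FamVertexOn G I p

/-- A region appears on the outer hull of the subfamily of G indexed by I. -/
def AppearsOn {n : ℕ} (G : Fin n → Set Plane) (I : Set (Fin n)) (R : Set Plane) : Prop :=
  ∃ p ∈ R, p ∈ OCHOn G I
/-- Frontier points of a set that is stable under adding the cone form a 1-Lipschitz graph. -/
lemma abs_sub_le_of_mem_frontier {K : Set Plane} (hC : ∀ v ∈ K, ∀ w ∈ quarterCone, v + w ∈ K)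
    {p q : Plane} (hp : p ∈ frontier K) (hq : q ∈ frontier K) :
    |p 1 - q 1| ≤ |p 0 - q 0| := by
  have aux : ∀ p q : Plane, p ∈ closure K → q ∉ interior K → p 1 - q 1 ≤ |p 0 - q 0| := by
    intro p q hp hq
    by_contra! h
    obtain ⟨v, hv, hvK⟩ := mem_closure_iff.1 hp {v : Plane | |v 0 - q 0| < v 1 - q 1}
      (isOpen_lt (by fun_prop) (by fun_prop)) h
    refine hq (mem_interior.2 ⟨{u : Plane | |v 0 - u 0| < v 1 - u 1}, fun u hu => ?_,
      isOpen_lt (by fun_prop) (by fun_prop), hv⟩)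
    have hcone : u - v ∈ quarterCone := by
      change (u - v) 1 ≤ -|(u - v) 0|
      have hu' : |v 0 - u 0| < v 1 - u 1 := hu
      rw [abs_sub_comm] at hu'
      simp only [PiLp.sub_apply]
      linarith
    simpa using hC v hvK _ hcone
  rw [abs_le]
  have h1 := aux p q hp.1 hq.2
  have h2 := aux q p hq.1 hp.2
  rw [abs_sub_comm] at h2
  constructor <;> linarith

lemma eq_of_mem_frontier {K : Set Plane} (hC : ∀ v ∈ K, ∀ w ∈ quarterCone, v + w ∈ K)
    {p q : Plane} (hp : p ∈ frontier K) (hq : q ∈ frontier K) (h : p 0 = q 0) : p = q := by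
  have h1 := abs_sub_le_of_mem_frontier hC hp hq
  rw [h, sub_self, abs_zero, abs_nonpos_iff, sub_eq_zero] at h1
  ext i
  fin_cases i
  · exact h
  · exact h1

/-- A non-vertical segment on the frontier has a common upward supporting normal. -/
lemma exists_unit_normal {K : Set Plane} (hK : Convex ℝ K)
    (hC : ∀ v ∈ K, ∀ w ∈ quarterCone, v + w ∈ K) {s t : Plane}
    (hst : segment ℝ s t ⊆ frontier K) (hlt : s 0 < t 0) :
    ∃ ν : Plane, ν 0 ^ 2 + ν 1 ^ 2 = 1 ∧ 0 < ν 1 ∧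
      ν 0 * s 0 + ν 1 * s 1 = ν 0 * t 0 + ν 1 * t 1 ∧
      ∀ v ∈ K, ν 0 * v 0 + ν 1 * v 1 ≤ ν 0 * s 0 + ν 1 * s 1 := by
  have hs := hst (left_mem_segment ℝ s t)
  have ht := hst (right_mem_segment ℝ s t)
  have hm := hst (midpoint_mem_segment s t)
  obtain ⟨f, hf⟩ := geometric_hahn_banach_open_point hK.interior isOpen_interior hm.2
  have hne : (interior K).Nonempty := by
    obtain ⟨v, hv⟩ : K.Nonempty := closure_nonempty_iff.1 ⟨s, hs.1⟩
    refine ⟨!₂[v 0, v 1 - 1], mem_interior.2 ⟨{u : Plane | |u 0 - v 0| < v 1 - u 1},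
      fun u hu => ?_, isOpen_lt (by fun_prop) (by fun_prop), by simp⟩⟩
    have hcone : u - v ∈ quarterCone := by
      change (u - v) 1 ≤ -|(u - v) 0|
      have hu' : |u 0 - v 0| < v 1 - u 1 := hu
      simp only [PiLp.sub_apply]
      linarith
    simpa using hC v hv _ hcone
  have hle : ∀ v ∈ closure K, f v ≤ f (midpoint ℝ s t) := by
    intro v hv
    rw [← hK.closure_interior_eq_closure_of_nonempty_interior hne] at hv
    exact closure_minimal (fun a ha => (hf a ha).le)
      (isClosed_le f.continuous continuous_const) hv
  have hmid : f (midpoint ℝ s t) = (f s + f t) / 2 := by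
    rw [midpoint_eq_smul_add, map_smul, map_add]
    simp
    ring
  have h1 := hle s hs.1
  have h2 := hle t ht.1
  have hst' : f s = f t := by linarith
  have hsup : ∀ v ∈ closure K, f v ≤ f s := fun v hv => by
    have := hle v hv
    linarith
  obtain ⟨a, b, hab⟩ : ∃ a b : ℝ, ∀ v : Plane, f v = a * v 0 + b * v 1 := by
    refine ⟨f !₂[1, 0], f !₂[0, 1], fun v => ?_⟩
    have hv : v = v 0 • !₂[1, 0] + v 1 • !₂[0, 1] := by
      ext i
      fin_cases i <;> simp
    conv_lhs => rw [hv]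
    rw [map_add, map_smul, map_smul]
    simp [mul_comm]
  have hb : 0 ≤ b := by
    have hmem : s + !₂[0, -1] ∈ closure K := by
      refine map_mem_closure (f := fun v : Plane => v + !₂[0, -1]) (by fun_prop) hs.1
        fun v hv => hC v hv _ ?_
      change (!₂[0, -1] : Plane) 1 ≤ -|(!₂[0, -1] : Plane) 0|
      simp
    have := hsup _ hmem
    rw [hab, hab] at this
    simp at this
    linarith
  rw [hab, hab] at hst'
  have hpos : 0 < b := by
    refine lt_of_le_of_ne hb fun hb0 => ?_
    have ha : a = 0 := by
      have : a * (t 0 - s 0) = 0 := by rw [← hb0] at hst'; linarith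
      rcases mul_eq_zero.1 this with h | h
      · exact h
      · linarith
    obtain ⟨v, hv⟩ := hne
    have := hf v hv
    rw [hab, hab, ha, ← hb0] at this
    simp at this
  have hn : 0 < a ^ 2 + b ^ 2 := by positivity
  have hsq := Real.sq_sqrt hn.le
  have hc : 0 < √(a ^ 2 + b ^ 2) := Real.sqrt_pos.2 hn
  set c := √(a ^ 2 + b ^ 2)
  have hdiv : ∀ v : Plane, a / c * v 0 + b / c * v 1 = (a * v 0 + b * v 1) / c := fun v => by ring
  refine ⟨!₂[a / c, b / c], ?_, ?_, ?_, fun v hv => ?_⟩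
  · simp only [Matrix.cons_val_zero, Matrix.cons_val_one]
    rw [div_pow, div_pow, ← add_div, hsq, div_self hn.ne']
  · simpa using div_pos hpos hc
  · simp only [Matrix.cons_val_zero, Matrix.cons_val_one, hdiv, hst']
  · simp only [Matrix.cons_val_zero, Matrix.cons_val_one, hdiv]
    have := hsup v (subset_closure hv)
    rw [hab, hab] at this
    gcongr

lemma mem_closedBall_iff_sq {z q : Plane} {ρ : ℝ} (hρ : 0 ≤ ρ) :
    q ∈ closedBall z ρ ↔ (q 0 - z 0) ^ 2 + (q 1 - z 1) ^ 2 ≤ ρ ^ 2 := by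
  rw [mem_closedBall, ← sq_le_sq₀ dist_nonneg hρ, EuclideanSpace.dist_sq_eq, Fin.sum_univ_two,
    Real.dist_eq, Real.dist_eq, sq_abs, sq_abs]

/-- The maximizer over a disk of a linear functional with unit normal. -/
lemma eq_add_of_forall_closedBall_le {z s ν : Plane} {ρ : ℝ} (hρ : 0 ≤ ρ)
    (hν : ν 0 ^ 2 + ν 1 ^ 2 = 1) (hs : s ∈ closedBall z ρ)
    (hmax : ∀ v ∈ closedBall z ρ, ν 0 * v 0 + ν 1 * v 1 ≤ ν 0 * s 0 + ν 1 * s 1) :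
    s 0 = z 0 + ρ * ν 0 ∧ s 1 = z 1 + ρ * ν 1 := by
  rw [mem_closedBall_iff_sq hρ] at hs
  have h := hmax !₂[z 0 + ρ * ν 0, z 1 + ρ * ν 1] (by
    rw [mem_closedBall_iff_sq hρ]
    simp only [Matrix.cons_val_zero, Matrix.cons_val_one]
    have : (z 0 + ρ * ν 0 - z 0) ^ 2 + (z 1 + ρ * ν 1 - z 1) ^ 2
      = ρ ^ 2 * (ν 0 ^ 2 + ν 1 ^ 2) := by ring
    rw [this, hν, mul_one])
  simp only [Matrix.cons_val_zero, Matrix.cons_val_one] at h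
  have h' : ρ ≤ ν 0 * (s 0 - z 0) + ν 1 * (s 1 - z 1) := by
    have : ρ * (ν 0 ^ 2 + ν 1 ^ 2) = ρ := by rw [hν, mul_one]
    linarith
  have h'' := mul_le_mul_of_nonneg_left h' hρ
  have hρν : ρ ^ 2 * (ν 0 ^ 2 + ν 1 ^ 2) = ρ ^ 2 := by rw [hν, mul_one]
  have key : (s 0 - z 0 - ρ * ν 0) ^ 2 + (s 1 - z 1 - ρ * ν 1) ^ 2 ≤ 0 := by linarith
  have h0 := sq_nonneg (s 0 - z 0 - ρ * ν 0)
  have h1 := sq_nonneg (s 1 - z 1 - ρ * ν 1)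
  have e0 : s 0 - z 0 - ρ * ν 0 = 0 := (pow_eq_zero_iff two_ne_zero).1 (by linarith)
  have e1 : s 1 - z 1 - ρ * ν 1 = 0 := (pow_eq_zero_iff two_ne_zero).1 (by linarith)
  exact ⟨by linarith, by linarith⟩

/-- A unit vector is determined by its inner product with `d` and the sign of its cross product
with `d`. -/
lemma unit_normal_unique {a b a' b' d e c : ℝ} (h : a ^ 2 + b ^ 2 = 1) (h' : a' ^ 2 + b' ^ 2 = 1)
    (hc : a * d + b * e = c) (hc' : a' * d + b' * e = c) (hw : a * e - b * d < 0)
    (hw' : a' * e - b' * d < 0) : a = a' ∧ b = b' := by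
  have hsq : (a * e - b * d) ^ 2 = (a' * e - b' * d) ^ 2 := by
    have h1 : (a * e - b * d) ^ 2 = (a ^ 2 + b ^ 2) * (d ^ 2 + e ^ 2) - (a * d + b * e) ^ 2 := by
      ring
    have h2 : (a' * e - b' * d) ^ 2
      = (a' ^ 2 + b' ^ 2) * (d ^ 2 + e ^ 2) - (a' * d + b' * e) ^ 2 := by ring
    rw [h1, h2, h, h', hc, hc']
  have hweq : a * e - b * d = a' * e - b' * d := by
    rcases sq_eq_sq_iff_eq_or_eq_neg.1 hsq with h | h
    · exact h
    · linarith
  have hde : 0 < d ^ 2 + e ^ 2 := by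
    by_contra! hle
    have hd : d = 0 := by nlinarith [sq_nonneg d, sq_nonneg e]
    have he : e = 0 := by nlinarith [sq_nonneg d, sq_nonneg e]
    simp [hd, he] at hw
  have ha : a * (d ^ 2 + e ^ 2) = a' * (d ^ 2 + e ^ 2) := by
    linear_combination d * (hc.trans hc'.symm) + e * hweq
  have hb : b * (d ^ 2 + e ^ 2) = b' * (d ^ 2 + e ^ 2) := by
    linear_combination e * (hc.trans hc'.symm) - d * hweq
  exact ⟨mul_right_cancel₀ hde.ne' ha, mul_right_cancel₀ hde.ne' hb⟩

/-- Two disks (possibly of radius zero) have at most one upper common tangent segment going from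
left to right, from the first disk to the second. -/
lemma tangent_segment_unique {K : Set Plane} (hK : Convex ℝ K)
    (hC : ∀ v ∈ K, ∀ w ∈ quarterCone, v + w ∈ K) {w w' : Plane} {ρ ρ' : ℝ} (hρ : 0 ≤ ρ)
    (hρ' : 0 ≤ ρ') (hw : closedBall w ρ ⊆ K) (hw' : closedBall w' ρ' ⊆ K) {s t s' t' : Plane}
    (hs : s ∈ closedBall w ρ) (ht : t ∈ closedBall w' ρ') (hs' : s' ∈ closedBall w ρ)
    (ht' : t' ∈ closedBall w' ρ') (hst : segment ℝ s t ⊆ frontier K)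
    (hst' : segment ℝ s' t' ⊆ frontier K) (hlt : s 0 < t 0) (hlt' : s' 0 < t' 0) :
    s = s' ∧ t = t' := by
  have key : ∀ {s t : Plane}, s ∈ closedBall w ρ → t ∈ closedBall w' ρ' →
      segment ℝ s t ⊆ frontier K → s 0 < t 0 → ∃ a b : ℝ, a ^ 2 + b ^ 2 = 1 ∧
        a * (w' 0 - w 0) + b * (w' 1 - w 1) = ρ - ρ' ∧
        a * (w' 1 - w 1) - b * (w' 0 - w 0) < 0 ∧
        s 0 = w 0 + ρ * a ∧ s 1 = w 1 + ρ * b ∧ t 0 = w' 0 + ρ' * a ∧ t 1 = w' 1 + ρ' * b := by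
    intro s t hs ht hst hlt
    obtain ⟨ν, hν, hν1, heq, hmax⟩ := exists_unit_normal hK hC hst hlt
    obtain ⟨hs0, hs1⟩ := eq_add_of_forall_closedBall_le hρ hν hs fun v hv => hmax v (hw hv)
    obtain ⟨ht0, ht1⟩ := eq_add_of_forall_closedBall_le hρ' hν ht fun v hv =>
      heq ▸ hmax v (hw' hv)
    refine ⟨ν 0, ν 1, hν, ?_, ?_, hs0, hs1, ht0, ht1⟩
    · rw [hs0, hs1, ht0, ht1] at heq
      linear_combination (ρ - ρ') * hν - heq
    · have hcross : ν 0 * (w' 1 - w 1) - ν 1 * (w' 0 - w 0)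
          = ν 0 * (t 1 - s 1) - ν 1 * (t 0 - s 0) := by
        rw [hs0, hs1, ht0, ht1]
        ring
      have hmul : (ν 0 * (t 1 - s 1) - ν 1 * (t 0 - s 0)) * ν 1 = -(t 0 - s 0) := by
        linear_combination -(t 0 - s 0) * hν - ν 0 * heq
      rw [hcross]
      by_contra! hge
      have := mul_nonneg hge hν1.le
      linarith
  obtain ⟨a, b, h, hc, hx, hs0, hs1, ht0, ht1⟩ := key hs ht hst hlt
  obtain ⟨a', b', h', hc', hx', hs0', hs1', ht0', ht1'⟩ := key hs' ht' hst' hlt'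
  obtain ⟨rfl, rfl⟩ := unit_normal_unique h h' hc hc' hx hx'
  constructor <;> ext i <;> fin_cases i
  · exact hs0.trans hs0'.symm
  · exact hs1.trans hs1'.symm
  · exact ht0.trans ht0'.symm
  · exact ht1.trans ht1'.symm

lemma exists_unit_closedBall_subset {z q : Plane} {r : ℝ} (hr : 1 ≤ r) (hq : q ∈ closedBall z r) :
    ∃ u, closedBall u 1 ⊆ closedBall z r ∧ q ∈ closedBall u 1 := by
  have hr0 : 0 < r := by linarith
  rw [mem_closedBall] at hq
  refine ⟨AffineMap.lineMap q z r⁻¹, closedBall_subset_closedBall' ?_, ?_⟩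
  · rw [dist_lineMap_right, Real.norm_eq_abs,
      abs_of_nonneg (sub_nonneg.2 (inv_le_one_of_one_le₀ hr))]
    have h1 : (1 - r⁻¹) * dist q z ≤ (1 - r⁻¹) * r :=
      mul_le_mul_of_nonneg_left hq (sub_nonneg.2 (inv_le_one_of_one_le₀ hr))
    have h2 : (1 - r⁻¹) * r = r - 1 := by field_simp
    linarith
  · rw [mem_closedBall, dist_left_lineMap, Real.norm_eq_abs, abs_of_nonneg (inv_nonneg.2 hr0.le),
      inv_mul_le_iff₀ hr0]
    linarith

/-- Few members of a disjoint family of disks of radius at least one meet a 1-Lipschitz graph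
above a fixed unit interval. -/
lemma encard_meeting_le {n : ℕ} {z : Fin n → Plane} {r : Fin n → ℝ} (hr : ∀ i, 1 ≤ r i)
    (hdisj : ∀ i j, i ≠ j → Disjoint (closedBall (z i) (r i)) (closedBall (z j) (r j)))
    {L : Set Plane} (hL : ∀ p ∈ L, ∀ q ∈ L, |p 1 - q 1| ≤ |p 0 - q 0|) (m : ℤ) :
    {i | ∃ q ∈ closedBall (z i) (r i), q ∈ L ∧ ⌊q 0⌋ = m}.encard ≤ 15 := by
  set S := {i | ∃ q ∈ closedBall (z i) (r i), q ∈ L ∧ ⌊q 0⌋ = m}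
  rcases S.eq_empty_or_nonempty with hS | ⟨i₀, q₀, -, hq₀, hm₀⟩
  · simp [hS]
  have hex : ∀ i, ∃ u : Plane, i ∈ S →
      closedBall u 1 ⊆ closedBall (z i) (r i) ∧ ∃ q ∈ closedBall u 1, q ∈ L ∧ ⌊q 0⌋ = m := by
    intro i
    by_cases hi : i ∈ S
    · obtain ⟨q, hq, hqL, hqm⟩ := hi
      obtain ⟨u, hu, hqu⟩ := exists_unit_closedBall_subset (hr i) hq
      exact ⟨u, fun _ => ⟨hu, q, hqu, hqL, hqm⟩⟩
    · exact ⟨0, fun h => absurd h hi⟩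
  choose u hu using hex
  have hcard : ((Finset.Icc (m - 1) (m + 1) ×ˢ Finset.Icc (⌊q₀ 1⌋ - 2) (⌊q₀ 1⌋ + 2) :
      Finset (ℤ × ℤ)) : Set (ℤ × ℤ)).encard = 15 := by
    rw [Set.encard_coe_eq_coe_finsetCard, Finset.card_product, Int.card_Icc, Int.card_Icc]
    have h1 : m + 1 + 1 - (m - 1) = 3 := by ring
    have h2 : ⌊q₀ 1⌋ + 2 + 1 - (⌊q₀ 1⌋ - 2) = 5 := by ring
    rw [h1, h2]
    rfl
  rw [← hcard]
  refine Set.encard_le_encard_of_injOn (f := fun i => (⌊u i 0⌋, ⌊u i 1⌋)) ?_ ?_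
  · intro i hi
    obtain ⟨-, q, hq, hqL, hqm⟩ := hu i hi
    rw [mem_closedBall_iff_sq zero_le_one] at hq
    have hx : |q 0 - u i 0| ≤ 1 := abs_le_one_iff_mul_self_le_one.2 (by nlinarith)
    have hy : |q 1 - u i 1| ≤ 1 := abs_le_one_iff_mul_self_le_one.2 (by nlinarith)
    have hlip := hL q hqL q₀ hq₀
    have hclose : |q 0 - q₀ 0| < 1 := Int.abs_sub_lt_one_of_floor_eq_floor (hqm.trans hm₀.symm)
    rw [Int.floor_eq_iff] at hqm
    have hy₀ := Int.floor_le (q₀ 1)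
    have hy₁ := Int.lt_floor_add_one (q₀ 1)
    rw [abs_le] at hx hy
    have hy' := abs_lt.1 (hlip.trans_lt hclose)
    simp only [Finset.coe_product, Finset.coe_Icc, Set.mem_prod, Set.mem_Icc]
    refine ⟨⟨Int.le_floor.2 ?_, Int.lt_add_one_iff.1 (Int.floor_lt.2 ?_)⟩,
      Int.le_floor.2 ?_, Int.lt_add_one_iff.1 (Int.floor_lt.2 ?_)⟩ <;> push_cast <;> linarith
  · intro i hi j hj hij
    by_contra hne
    simp only [Prod.mk.injEq] at hij
    have hx := Int.abs_sub_lt_one_of_floor_eq_floor hij.1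
    have hy := Int.abs_sub_lt_one_of_floor_eq_floor hij.2
    have hx2 := (sq_lt_one_iff_abs_lt_one _).2 hx
    have hy2 := (sq_lt_one_iff_abs_lt_one _).2 hy
    refine (hdisj i j hne).notMem_of_mem_left (a := midpoint ℝ (u i) (u j))
      ((hu i hi).1 ?_) ((hu j hj).1 ?_)
    all_goals
      rw [mem_closedBall_iff_sq zero_le_one]
      simp only [midpoint_eq_smul_add, PiLp.smul_apply, PiLp.add_apply, smul_eq_mul, invOf_eq_inv]
      nlinarith

/-- No vertex lies strictly above the interior of an edge. -/
lemma IsEdgeOn.not_between {n : ℕ} {G : Fin n → Set Plane} {I : Set (Fin n)}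
    (hC : ∀ v ∈ convexHull ℝ (⋃ i ∈ I, G i) + quarterCone, ∀ w ∈ quarterCone,
      v + w ∈ convexHull ℝ (⋃ i ∈ I, G i) + quarterCone)
    {s t p : Plane} (h : IsEdgeOn G I s t) (hp : p ∈ OCHOn G I) (hv : FamVertexOn G I p)
    (h1 : s 0 < p 0) (h2 : p 0 < t 0) : False := by
  obtain ⟨-, -, -, hseg, hno⟩ := h
  have hst : 0 < t 0 - s 0 := by linarith
  set c := (p 0 - s 0) / (t 0 - s 0)
  have hc0 : 0 < c := div_pos (by linarith) hst
  have hc1 : c < 1 := (div_lt_one hst).2 (by linarith)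
  have hmem : AffineMap.lineMap s t c ∈ openSegment ℝ s t := by
    rw [openSegment_eq_image_lineMap]
    exact ⟨c, ⟨hc0, hc1⟩, rfl⟩
  refine hno _ hmem ?_
  have heq : AffineMap.lineMap s t c = p := by
    refine eq_of_mem_frontier hC (hseg (openSegment_subset_segment ℝ s t hmem)) hp ?_
    simp only [AffineMap.lineMap_apply, vsub_eq_sub, vadd_eq_add, PiLp.add_apply, PiLp.smul_apply,
      PiLp.sub_apply, smul_eq_mul]
    rw [div_mul_cancel₀ _ hst.ne']
    ring
  rwa [heq]

lemma IsEdgeOn.symm {n : ℕ} {G : Fin n → Set Plane} {I : Set (Fin n)} {s t : Plane}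
    (h : IsEdgeOn G I s t) : IsEdgeOn G I t s := by
  obtain ⟨hne, hs, ht, hseg, hno⟩ := h
  rw [segment_symm] at hseg
  rw [openSegment_symm] at hno
  exact ⟨hne.symm, ht, hs, hseg, hno⟩

lemma convex_quarterCone : Convex ℝ quarterCone := by
  intro p hp q hq a b ha hb _
  change p 1 ≤ -|p 0| at hp
  change q 1 ≤ -|q 0| at hq
  change (a • p + b • q) 1 ≤ -|(a • p + b • q) 0|
  simp only [PiLp.add_apply, PiLp.smul_apply, smul_eq_mul]
  have h1 := abs_add_le (a * p 0) (b * q 0)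
  rw [abs_mul, abs_mul, abs_of_nonneg ha, abs_of_nonneg hb] at h1
  nlinarith [mul_le_mul_of_nonneg_left hp ha, mul_le_mul_of_nonneg_left hq hb]

lemma add_mem_add_quarterCone (T : Set Plane) :
    ∀ v ∈ T + quarterCone, ∀ w ∈ quarterCone, v + w ∈ T + quarterCone := by
  rintro _ ⟨a, ha, b, hb, rfl⟩ w hw
  refine ⟨a, ha, b + w, ?_, (add_assoc _ _ _).symm⟩
  change b 1 ≤ -|b 0| at hb
  change w 1 ≤ -|w 0| at hw
  change (b + w) 1 ≤ -|(b + w) 0|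
  simp only [PiLp.add_apply]
  linarith [abs_add_le (b 0) (w 0)]

lemma subset_hull_add_quarterCone {n : ℕ} (G : Fin n → Set Plane) {I : Set (Fin n)} {i : Fin n}
    (hi : i ∈ I) : G i ⊆ convexHull ℝ (⋃ i ∈ I, G i) + quarterCone := by
  intro v hv
  refine ⟨v, subset_convexHull ℝ _ (Set.mem_biUnion hi hv), 0, ?_, add_zero v⟩
  change (0 : Plane) 1 ≤ -|(0 : Plane) 0|
  simp

/-- Edges directed from left to right whose left endpoint lies above a fixed unit interval. -/
def rightEdgesAt {n : ℕ} (G : Fin n → Set Plane) (I : Set (Fin n)) (m : ℤ) : Set (Plane × Plane) :=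
  {e | IsEdgeOn G I e.1 e.2 ∧ e.1 0 < e.2 0 ∧ ⌊e.1 0⌋ = m}

lemma encard_rightEdgesAt_le {n : ℕ} {z w : Fin n → Plane} {r ρ : Fin n → ℝ} (hr : ∀ i, 1 ≤ r i)
    (hdisj : ∀ i j, i ≠ j → Disjoint (closedBall (z i) (r i)) (closedBall (z j) (r j)))
    (hρ : ∀ i, 0 ≤ ρ i) (hsub : ∀ i, closedBall (w i) (ρ i) ⊆ closedBall (z i) (r i))
    (I : Set (Fin n)) (m : ℤ) :
    (rightEdgesAt (fun i => closedBall (w i) (ρ i)) I m).encard ≤ 226 := by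
  set G : Fin n → Set Plane := fun i => closedBall (w i) (ρ i) with hG
  have hC := add_mem_add_quarterCone (convexHull ℝ (⋃ i ∈ I, G i))
  have hK : Convex ℝ (convexHull ℝ (⋃ i ∈ I, G i) + quarterCone) :=
    (convex_convexHull ℝ _).add convex_quarterCone
  have hvert : ∀ p, FamVertexOn G I p → ∃ i ∈ I, p ∈ closedBall (w i) (ρ i) := by
    rintro p ⟨i, hi, hp, -⟩
    exact ⟨i, hi, isClosed_closedBall.frontier_subset hp⟩
  have hleft : ∀ {s t : Plane}, IsEdgeOn G I s t → s ∈ OCHOn G I := fun h =>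
    h.2.2.2.1 (left_mem_segment ℝ _ _)
  have hright : ∀ {s t : Plane}, IsEdgeOn G I s t → t ∈ OCHOn G I := fun h =>
    h.2.2.2.1 (right_mem_segment ℝ _ _)
  set long := {e ∈ rightEdgesAt G I m | ⌊e.2 0⌋ ≠ m}
  set short := {e ∈ rightEdgesAt G I m | ⌊e.2 0⌋ = m}
  set M := {i | ∃ q ∈ closedBall (z i) (r i), q ∈ OCHOn G I ∧ ⌊q 0⌋ = m}
  have hM : M.encard ≤ 15 := encard_meeting_le hr hdisj
    (fun p hp q hq => abs_sub_le_of_mem_frontier hC hp hq) m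
  have hlong : long.encard ≤ 1 := by
    have hlt : ∀ e ∈ long, ∀ e' ∈ long, e.1 0 < e'.2 0 := by
      rintro ⟨s, t⟩ ⟨⟨-, -, hs⟩, -⟩ ⟨s', t'⟩ ⟨⟨-, hst', hs'⟩, ht'⟩
      have hle : ⌊s' 0⌋ ≤ ⌊t' 0⌋ := Int.floor_mono hst'.le
      dsimp only at *
      exact Int.floor_mono.reflect_lt (by omega)
    rw [Set.encard_le_one_iff]
    rintro ⟨s, t⟩ ⟨s', t'⟩ he he'
    have h12 := hlt _ he' _ he
    have h21 := hlt _ he _ he'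
    obtain ⟨⟨hE, hst, -⟩, -⟩ := he
    obtain ⟨⟨hE', hst', -⟩, -⟩ := he'
    dsimp only at *
    have hss : s = s' := by
      refine eq_of_mem_frontier hC (hleft hE) (hleft hE') ?_
      rcases lt_trichotomy (s 0) (s' 0) with h | h | h
      · exact (hE.not_between hC (hleft hE') hE'.2.1 h h12).elim
      · exact h
      · exact (hE'.not_between hC (hleft hE) hE.2.1 h h21).elim
    subst hss
    have htt : t = t' := by
      refine eq_of_mem_frontier hC (hright hE) (hright hE') ?_
      rcases lt_trichotomy (t 0) (t' 0) with h | h | h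
      · exact (hE'.not_between hC (hright hE) hE.2.2.1 hst h).elim
      · exact h
      · exact (hE.not_between hC (hright hE') hE'.2.2.1 hst' h).elim
    rw [htt]
  have hshort : short.encard ≤ 225 := by
    have hex : ∀ e ∈ short, ∃ ij : Fin n × Fin n,
        (ij.1 ∈ I ∧ e.1 ∈ closedBall (w ij.1) (ρ ij.1)) ∧
          (ij.2 ∈ I ∧ e.2 ∈ closedBall (w ij.2) (ρ ij.2)) := by
      intro e he
      obtain ⟨i, hi⟩ := hvert _ he.1.1.2.1
      obtain ⟨j, hj⟩ := hvert _ he.1.1.2.2.1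
      exact ⟨(i, j), hi, hj⟩
    rcases isEmpty_or_nonempty (Fin n) with hn | hn
    · rw [(Set.eq_empty_iff_forall_notMem.2 fun e he => hn.elim (hex e he).choose.1 : short = ∅)]
      simp
    choose! f hf using hex
    calc short.encard ≤ (M ×ˢ M).encard := by
          refine Set.encard_le_encard_of_injOn (f := f) ?_ ?_
          · intro e he
            obtain ⟨⟨-, h1⟩, -, h2⟩ := hf e he
            exact ⟨⟨e.1, hsub _ h1, hleft he.1.1, he.1.2.2⟩,
              ⟨e.2, hsub _ h2, hright he.1.1, he.2⟩⟩
          · intro e he e' he' hee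
            obtain ⟨⟨hi, h1⟩, hj, h2⟩ := hf e he
            obtain ⟨⟨-, h1'⟩, -, h2'⟩ := hf e' he'
            rw [← hee] at h1' h2'
            obtain ⟨ha, hb⟩ := tangent_segment_unique hK hC (hρ _) (hρ _)
              (subset_hull_add_quarterCone G hi) (subset_hull_add_quarterCone G hj) h1 h2 h1' h2'
              he.1.1.2.2.2.1 he'.1.1.2.2.2.1 he.1.2.1 he'.1.2.1
            exact Prod.ext ha hb
      _ ≤ 15 * 15 := by
          rw [Set.encard_prod]
          gcongr
      _ = 225 := by norm_num
  calc (rightEdgesAt G I m).encard ≤ (long ∪ short).encard := by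
        refine Set.encard_le_encard fun e he => ?_
        by_cases h : ⌊e.2 0⌋ = m
        · exact Or.inr ⟨he, h⟩
        · exact Or.inl ⟨he, h⟩
    _ ≤ long.encard + short.encard := Set.encard_union_le _ _
    _ ≤ 1 + 225 := add_le_add hlong hshort
    _ = 226 := by norm_num

/-- A set covered by boundedly many fibres over the integer points of an interval of
length `2 * k`. -/
lemma ncard_le_of_cover {α : Type*} {T : Set α} {f : ℤ → Set α} {N : ℕ} {k x₀ : ℝ} (hk : 1 ≤ k)
    (hcov : ∀ a ∈ T, ∃ m ∈ Finset.Icc ⌊x₀⌋ ⌊x₀ + 2 * k⌋, a ∈ f m)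
    (hf : ∀ m, (f m).encard ≤ N) : (T.ncard : ℝ) ≤ 4 * N * k := by
  set J := Finset.Icc ⌊x₀⌋ ⌊x₀ + 2 * k⌋ with hJ
  have hT : T.encard ≤ (J.card * N : ℕ) :=
    calc T.encard ≤ (⋃ m ∈ J, f m).encard := Set.encard_le_encard fun a ha => by
          obtain ⟨m, hm, ham⟩ := hcov a ha
          exact Set.mem_biUnion hm ham
      _ ≤ ∑ m ∈ J, (f m).encard := J.set_encard_biUnion_le f
      _ ≤ ∑ m ∈ J, (N : ℕ∞) := Finset.sum_le_sum fun m _ => hf m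
      _ = (J.card * N : ℕ) := by simp
  have hJk : (J.card : ℝ) ≤ 4 * k := by
    have hnn : 0 ≤ ⌊x₀ + 2 * k⌋ + 1 - ⌊x₀⌋ := by
      have : ⌊x₀⌋ ≤ ⌊x₀ + 2 * k⌋ := Int.floor_mono (by linarith)
      omega
    have hc : (J.card : ℝ) = ⌊x₀ + 2 * k⌋ + 1 - ⌊x₀⌋ := by
      rw [hJ, Int.card_Icc]
      exact_mod_cast Int.toNat_of_nonneg hnn
    rw [hc]
    linarith [Int.floor_le (x₀ + 2 * k), Int.lt_floor_add_one x₀]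
  have hle : T.ncard ≤ J.card * N := ENat.toNat_le_of_le_natCast hT
  calc (T.ncard : ℝ) ≤ J.card * N := by exact_mod_cast hle
    _ ≤ 4 * k * N := by gcongr
    _ = 4 * N * k := by ring

/-- hull complexity of pairwise disjoint disks with radii in [1, k]
(after arbitrary retrievals) restricted to a vertical slab of width 2k. -/
theorem hull_complexity_disjoint_disks :
    ∃ c : ℝ, 0 < c ∧
      ∀ (k : ℝ), 1 ≤ k →
      ∀ (n : ℕ) (z : Fin n → Plane) (r : Fin n → ℝ),
        (∀ i, r i ∈ Set.Icc 1 k) →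
        (∀ i j, i ≠ j →
          Disjoint (Metric.closedBall (z i) (r i)) (Metric.closedBall (z j) (r j))) →
      ∀ (A : Set (Fin n)) (p : Fin n → Plane),
        (∀ i ∈ A, p i ∈ Metric.closedBall (z i) (r i)) →
      ∀ (x₀ : ℝ) (G : Fin n → Set Plane),
        G = (fun i => if i ∈ A then {p i} else Metric.closedBall (z i) (r i)) →
      ∀ I : Set (Fin n),
        I = {i | G i ⊆ {q : Plane | x₀ ≤ q 0 ∧ q 0 ≤ x₀ + 2 * k}} →
        (Set.ncard {e : Plane × Plane | IsEdgeOn G I e.1 e.2} : ℝ) ≤ c * k ∧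
        (Set.ncard {i ∈ I | AppearsOn G I (G i)} : ℝ) ≤ c * k := by
  refine ⟨1808, by norm_num, ?_⟩
  intro k hk n z r hr hdisj A p hp x₀ G hG I hI
  set w : Fin n → Plane := fun i => if i ∈ A then p i else z i
  set ρ : Fin n → ℝ := fun i => if i ∈ A then 0 else r i
  have hGball : G = fun i => closedBall (w i) (ρ i) := by
    rw [hG]
    funext i
    by_cases hi : i ∈ A <;> simp [w, ρ, hi]
  have hr1 : ∀ i, 1 ≤ r i := fun i => (hr i).1
  have hρ : ∀ i, 0 ≤ ρ i := fun i => by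
    have := hr1 i
    by_cases hi : i ∈ A <;> simp only [ρ, hi, if_true, if_false] <;> linarith
  have hsub : ∀ i, closedBall (w i) (ρ i) ⊆ closedBall (z i) (r i) := fun i => by
    by_cases hi : i ∈ A
    · simpa [w, ρ, hi] using hp i hi
    · simp [w, ρ, hi]
  have hC := add_mem_add_quarterCone (convexHull ℝ (⋃ i ∈ I, G i))
  have hfloor : ∀ i ∈ I, ∀ q ∈ G i, ⌊q 0⌋ ∈ Finset.Icc ⌊x₀⌋ ⌊x₀ + 2 * k⌋ := by
    intro i hi q hq
    rw [hI] at hi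
    exact Finset.mem_Icc.2 ⟨Int.floor_mono (hi hq).1, Int.floor_mono (hi hq).2⟩
  have hvert : ∀ q, FamVertexOn G I q → ⌊q 0⌋ ∈ Finset.Icc ⌊x₀⌋ ⌊x₀ + 2 * k⌋ := by
    rintro q ⟨i, hi, hq, -⟩
    refine hfloor i hi q ?_
    rw [hGball] at hq ⊢
    exact isClosed_closedBall.frontier_subset hq
  have hedge : ∀ m, (rightEdgesAt G I m).encard ≤ 226 := fun m => by
    rw [hGball]
    exact encard_rightEdgesAt_le hr1 hdisj hρ hsub I m
  constructor
  · have hcount := ncard_le_of_cover (T := {e : Plane × Plane | IsEdgeOn G I e.1 e.2})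
      (f := fun m => rightEdgesAt G I m ∪ Prod.swap '' rightEdgesAt G I m) (N := 452) (x₀ := x₀)
      hk ?_ ?_
    · norm_num at hcount
      linarith
    · rintro ⟨s, t⟩ (h : IsEdgeOn G I s t)
      rcases lt_trichotomy (s 0) (t 0) with hlt | heq | hlt
      · exact ⟨_, hvert s h.2.1, Or.inl ⟨h, hlt, rfl⟩⟩
      · exact absurd (eq_of_mem_frontier hC (h.2.2.2.1 (left_mem_segment ℝ s t))
          (h.2.2.2.1 (right_mem_segment ℝ s t)) heq) h.1
      · exact ⟨_, hvert t h.2.2.1, Or.inr ⟨(t, s), ⟨h.symm, hlt, rfl⟩, rfl⟩⟩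
    · intro m
      calc _ ≤ (rightEdgesAt G I m).encard + (Prod.swap '' rightEdgesAt G I m).encard :=
            Set.encard_union_le _ _
        _ ≤ 226 + 226 := add_le_add (hedge m) ((Set.encard_image_le _ _).trans (hedge m))
        _ = (452 : ℕ) := by norm_num
  · have hcount := ncard_le_of_cover (T := {i ∈ I | AppearsOn G I (G i)})
      (f := fun m => {i | ∃ q ∈ closedBall (z i) (r i), q ∈ OCHOn G I ∧ ⌊q 0⌋ = m}) (N := 15)
      (x₀ := x₀) hk ?_ ?_
    · norm_num at hcount
      linarith
    · rintro i ⟨hi, q, hq, hqO⟩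
      refine ⟨_, hfloor i hi q hq, q, hsub i ?_, hqO, rfl⟩
      rw [hGball] at hq
      exact hq
    · exact encard_meeting_le hr1 hdisj
        fun p hp q hq => abs_sub_le_of_mem_frontier hC hp hq
end
end

section
/- There is an absolute constant c > 0 such that the following holds. Let k ≥ 1 and let F be either a family of pairwise disjoint closed disks in ℝ² with radii in [1, k], or a family of closed disks of radius 1 in ℝ² in which every point of ℝ² lies in at most k disks. Let ℓ be a vertical line and let F' = { R ∈ F : R ∩ ℓ ≠ ∅ }. Then the upper quarter outer convex hull OCH(F') has at most c·k edges. -/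
open scoped Classical
open Pointwise Set Metric

noncomputable section

/-- `p` is a point of `S` at which the linear functional `q ↦ q 1 + a * q 0` is maximal. -/
def IsUpperContact (S : Set Plane) (a : ℝ) (p : Plane) : Prop :=
  p ∈ S ∧ ∀ q ∈ S, q 1 + a * q 0 ≤ p 1 + a * p 0

lemma plane_ext {p q : Plane} (h0 : p 0 = q 0) (h1 : p 1 = q 1) : p = q := by
  ext i
  fin_cases i
  · exact h0
  · exact h1

lemma mem_hull_of_cone {S : Set Plane} {s q : Plane} (hs : s ∈ S)
    (hq : q 1 - s 1 ≤ -|q 0 - s 0|) : q ∈ convexHull ℝ S + quarterCone :=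
  ⟨s, subset_convexHull ℝ S hs, q - s, by simpa [quarterCone] using hq, by simp⟩

/-- A segment on the quarter hull of `S` with endpoints in `S` lies on a common supporting
line of slope at most one in absolute value. -/
lemma exists_isUpperContact_of_segment_subset_frontier {S : Set Plane} {s t : Plane}
    (hs : s ∈ S) (ht : t ∈ S)
    (hst : segment ℝ s t ⊆ frontier (convexHull ℝ S + quarterCone)) :
    ∃ a : ℝ, |a| ≤ 1 ∧ IsUpperContact S a s ∧ IsUpperContact S a t := by
  set K := convexHull ℝ S + quarterCone with hK
  have hconv : Convex ℝ K := (convex_convexHull ℝ S).add convex_quarterCone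
  have hm : midpoint ℝ s t ∉ interior K := (hst (midpoint_mem_segment s t)).2
  obtain ⟨f, hf⟩ := geometric_hahn_banach_open_point hconv.interior isOpen_interior hm
  have hne : (interior K).Nonempty := by
    refine ⟨s + !₂[0, -1], ?_⟩
    have hU : IsOpen {q : Plane | q 1 - s 1 < -|q 0 - s 0|} :=
      isOpen_lt (by fun_prop) (by fun_prop)
    refine interior_maximal (fun q hq => mem_hull_of_cone hs (le_of_lt hq)) hU ?_
    change (s + !₂[0, -1] : Plane) 1 - s 1 < -|(s + !₂[0, -1] : Plane) 0 - s 0|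
    simp
  have hle : ∀ q ∈ K, f q ≤ f (midpoint ℝ s t) := by
    intro q hq
    have hq' : q ∈ closure (interior K) := by
      rw [hconv.closure_interior_eq_closure_of_nonempty_interior hne]
      exact subset_closure hq
    exact closure_minimal (fun x hx => (hf x hx).le)
      (isClosed_le f.continuous continuous_const) hq'
  have hSK : ∀ q ∈ S, q ∈ K := fun q hq => mem_hull_of_cone hq (by simp)
  have hmid : f (midpoint ℝ s t) = (f s + f t) / 2 := by
    rw [midpoint_eq_smul_add]
    simp
    ring
  obtain ⟨α, hα⟩ : ∃ α, α = f !₂[1, 0] := ⟨_, rfl⟩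
  obtain ⟨β, hβ⟩ : ∃ β, β = f !₂[0, 1] := ⟨_, rfl⟩
  have hfc : ∀ q : Plane, f q = q 0 * α + q 1 * β := by
    intro q
    have : q = q 0 • !₂[(1 : ℝ), 0] + q 1 • !₂[(0 : ℝ), 1] := by
      apply plane_ext <;> simp
    conv_lhs => rw [this]
    rw [map_add, map_smul, map_smul, hα, hβ]
    rfl
  have hs' := hle s (hSK s hs)
  have ht' := hle t (hSK t ht)
  have hl := hle (s + !₂[-1, -1]) (mem_hull_of_cone hs (by simp))
  have hr := hle (s + !₂[1, -1]) (mem_hull_of_cone hs (by simp))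
  obtain ⟨o, ho⟩ := hne
  have hlt := hf o ho
  rw [hfc s, hfc t] at hmid
  rw [hmid, hfc] at hs' ht' hl hr hlt
  simp at hl hr
  have h1 : -α ≤ β := by linarith
  have h2 : α ≤ β := by linarith
  have hpos : 0 < β := by
    rcases lt_or_ge 0 β with h | h
    · exact h
    · have hβ0 : β = 0 := by linarith
      have hα0 : α = 0 := by linarith
      simp only [hβ0, hα0, mul_zero, add_zero, zero_div, lt_irrefl] at hlt
  have key : ∀ p q : Plane, q 0 * α + q 1 * β ≤ p 0 * α + p 1 * β →
      q 1 + α / β * q 0 ≤ p 1 + α / β * p 0 := by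
    intro p q h
    rw [← mul_le_mul_iff_of_pos_right hpos]
    field_simp
    linarith
  refine ⟨α / β, ?_, ⟨hs, fun q hq => key _ _ ?_⟩, ⟨ht, fun q hq => key _ _ ?_⟩⟩
  · rw [abs_div, abs_of_pos hpos, div_le_one hpos]
    exact abs_le.2 ⟨by linarith, h2⟩
  · have := hle q (hSK q hq)
    rw [hmid, hfc] at this
    linarith
  · have := hle q (hSK q hq)
    rw [hmid, hfc] at this
    linarith

lemma IsEdgeOn.exists_isUpperContact {n : ℕ} {G : Fin n → Set Plane} {I : Set (Fin n)}
    {s t : Plane} (hG : ∀ i, IsClosed (G i)) (h : IsEdgeOn G I s t) :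
    ∃ a : ℝ, |a| ≤ 1 ∧ IsUpperContact (⋃ i ∈ I, G i) a s ∧ IsUpperContact (⋃ i ∈ I, G i) a t := by
  obtain ⟨-, ⟨i, hi, hs⟩, ⟨j, hj, ht⟩, hst, -⟩ := h
  exact exists_isUpperContact_of_segment_subset_frontier
    (mem_biUnion hi ((hG i).frontier_subset hs.1))
    (mem_biUnion hj ((hG j).frontier_subset ht.1)) hst

lemma IsUpperContact.eq_of_fst_eq {S : Set Plane} {a b : ℝ} {p q : Plane}
    (hp : IsUpperContact S a p) (hq : IsUpperContact S b q) (h : p 0 = q 0) : p = q := by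
  refine plane_ext h ?_
  have h1 := hp.2 q hq.1
  have h2 := hq.2 p hp.1
  rw [h] at h1 h2
  linarith

lemma IsUpperContact.mem_openSegment {S : Set Plane} {a b : ℝ} {s t p : Plane}
    (hs : IsUpperContact S a s) (ht : IsUpperContact S a t) (hp : IsUpperContact S b p)
    (h1 : s 0 < p 0) (h2 : p 0 < t 0) :
    p ∈ openSegment ℝ s t := by
  have hd : 0 < t 0 - s 0 := by linarith
  have e1 := hs.2 t ht.1
  have e2 := ht.2 s hs.1
  have e3 := hs.2 p hp.1
  have e4 := hp.2 s hs.1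
  have e5 := hp.2 t ht.1
  have e6 : t 1 - s 1 = -a * (t 0 - s 0) := by linarith
  have e7 : p 1 - s 1 = -a * (p 0 - s 0) := by
    apply le_antisymm
    · linarith
    · have h3 := mul_le_mul_of_nonneg_left e4 (sub_pos.2 h2).le
      have h4 := mul_le_mul_of_nonneg_left e5 (sub_pos.2 h1).le
      have h5 : t 1 = s 1 - a * (t 0 - s 0) := by linarith
      rw [h5] at h4
      rw [← mul_le_mul_iff_of_pos_right hd]
      nlinarith
  refine ⟨(t 0 - p 0) / (t 0 - s 0), (p 0 - s 0) / (t 0 - s 0), div_pos (by linarith) hd,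
    div_pos (by linarith) hd, by field_simp; ring, plane_ext ?_ ?_⟩
  · simp
    field_simp
    ring
  · have h5 : t 1 = s 1 - a * (t 0 - s 0) := by linarith
    have h6 : p 1 = s 1 - a * (p 0 - s 0) := by linarith
    simp
    rw [h5, h6]
    field_simp
    ring

/-- Vertices of the family on the hull do not project into the projection of an edge. -/
lemma IsEdgeOn.not_between_s15 {n : ℕ} {G : Fin n → Set Plane} {I : Set (Fin n)}
    {s t s' t' : Plane} (hG : ∀ i, IsClosed (G i)) (h : IsEdgeOn G I s t)
    (h' : IsEdgeOn G I s' t') (h1 : s 0 < s' 0) : t 0 ≤ s' 0 := by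
  by_contra! h2
  obtain ⟨a, -, hs, ht⟩ := h.exists_isUpperContact hG
  obtain ⟨b, -, hs', -⟩ := h'.exists_isUpperContact hG
  exact h.2.2.2.2 s' (hs.mem_openSegment ht hs' h1 h2) h'.2.1

/-- Edges traversed from left to right are determined by the abscissa of the left endpoint. -/
lemma IsEdgeOn.eq_of_fst_eq {n : ℕ} {G : Fin n → Set Plane} {I : Set (Fin n)}
    {s t s' t' : Plane} (hG : ∀ i, IsClosed (G i)) (h : IsEdgeOn G I s t)
    (h' : IsEdgeOn G I s' t') (hst : s 0 < t 0) (hst' : s' 0 < t' 0) (h1 : s 0 = s' 0) :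
    s = s' ∧ t = t' := by
  obtain ⟨a, -, hs, ht⟩ := h.exists_isUpperContact hG
  obtain ⟨b, -, hs', ht'⟩ := h'.exists_isUpperContact hG
  refine ⟨hs.eq_of_fst_eq hs' h1, ht.eq_of_fst_eq ht' ?_⟩
  rcases lt_trichotomy (t 0) (t' 0) with h2 | h2 | h2
  · have := h'.not_between_s15 hG h.symm (by linarith)
    linarith
  · exact h2
  · have := h.not_between_s15 hG h'.symm (by linarith)
    linarith

lemma mem_closedBall_plane {z q : Plane} {r : ℝ} (hr : 0 ≤ r) :
    q ∈ closedBall z r ↔ (q 0 - z 0) ^ 2 + (q 1 - z 1) ^ 2 ≤ r ^ 2 := by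
  rw [mem_closedBall, EuclideanSpace.dist_eq, Real.sqrt_le_left hr]
  simp [Fin.sum_univ_two, Real.dist_eq, sq_abs]

/-- The point of a disk that is extreme for the functional `q ↦ q 1 + a * q 0`. -/
lemma IsUpperContact.eq_of_mem_closedBall {S : Set Plane} {a r : ℝ} {z s : Plane} (hr : 0 ≤ r)
    (hs : IsUpperContact S a s) (hz : closedBall z r ⊆ S) (hsz : s ∈ closedBall z r) :
    s 0 = z 0 + r * (a / √(1 + a ^ 2)) ∧ s 1 = z 1 + r * (1 / √(1 + a ^ 2)) := by
  obtain ⟨L, hL⟩ : ∃ L, L = √(1 + a ^ 2) := ⟨_, rfl⟩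
  rw [← hL]
  have hpos : 0 < L := hL ▸ Real.sqrt_pos.2 (by positivity)
  have hsq : L ^ 2 = 1 + a ^ 2 := by rw [hL, Real.sq_sqrt (by positivity)]
  have hunit : (a / L) ^ 2 + (1 / L) ^ 2 = 1 := by
    field_simp
    linarith
  have htop := hs.2 (z + !₂[r * (a / L), r * (1 / L)])
    (hz ((mem_closedBall_plane hr).2 (le_of_eq (by
      simp only [PiLp.add_apply, Matrix.cons_val_zero, Matrix.cons_val_one]
      linear_combination r ^ 2 * hunit))))
  rw [mem_closedBall_plane hr] at hsz
  simp only [PiLp.add_apply, Matrix.cons_val_zero, Matrix.cons_val_one] at htop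
  have ha : a = a / L * L := by field_simp
  have hone : 1 = 1 / L * L := by field_simp
  set x := a / L
  set y := 1 / L
  have hy : 0 < y := by positivity
  have h3 := mul_le_mul_of_nonneg_left htop (mul_nonneg hr hy.le)
  have hyx : y * a = x := by linear_combination y * ha - x * hone
  have h4 : (s 0 - z 0 - r * x) ^ 2 + (s 1 - z 1 - r * y) ^ 2 ≤ 0 := by
    have : r * y * (z 1 + r * y + a * (z 0 + r * x)) =
      r * (y * z 1 + x * z 0) + r ^ 2 := by
      linear_combination (r * z 0 + r ^ 2 * x) * hyx + r ^ 2 * hunit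
    have h6 : r * y * (s 1 + a * s 0) = r * (y * s 1 + x * s 0) := by
      linear_combination (r * s 0) * hyx
    rw [this, h6] at h3
    nlinarith
  constructor
  · nlinarith [sq_nonneg (s 0 - z 0 - r * x), sq_nonneg (s 1 - z 1 - r * y)]
  · nlinarith [sq_nonneg (s 0 - z 0 - r * x), sq_nonneg (s 1 - z 1 - r * y)]

/-- A common tangent segment of two disjoint disks of radius at least one, of slope at most one,
has horizontal extent more than one. -/
lemma one_lt_of_disjoint {S : Set Plane} {a r r' : ℝ} {z z' s t : Plane} (hr : 1 ≤ r)
    (hr' : 1 ≤ r') (ha : |a| ≤ 1) (hs : IsUpperContact S a s) (ht : IsUpperContact S a t)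
    (hz : closedBall z r ⊆ S) (hz' : closedBall z' r' ⊆ S) (hsz : s ∈ closedBall z r)
    (htz : t ∈ closedBall z' r') (hst : s 0 < t 0)
    (hd : Disjoint (closedBall z r) (closedBall z' r')) : s 0 + 1 < t 0 := by
  have hr0 : 0 ≤ r := by linarith
  have hr0' : 0 ≤ r' := by linarith
  obtain ⟨hs0, hs1⟩ := hs.eq_of_mem_closedBall hr0 hz hsz
  obtain ⟨ht0, ht1⟩ := ht.eq_of_mem_closedBall hr0' hz' htz
  have hst1 : t 1 - s 1 = -a * (t 0 - s 0) := by
    linarith [hs.2 t ht.1, ht.2 s hs.1]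
  have hdist : (r + r') ^ 2 < (z 0 - z' 0) ^ 2 + (z 1 - z' 1) ^ 2 := by
    rw [disjoint_closedBall_closedBall_iff hr0 hr0', EuclideanSpace.dist_eq,
      Real.lt_sqrt (by positivity)] at hd
    simpa [Fin.sum_univ_two, Real.dist_eq, sq_abs] using hd
  obtain ⟨L, hL⟩ : ∃ L, L = √(1 + a ^ 2) := ⟨_, rfl⟩
  rw [← hL] at hs0 hs1 ht0 ht1
  have hpos : 0 < L := hL ▸ Real.sqrt_pos.2 (by positivity)
  have hsq : L ^ 2 = 1 + a ^ 2 := by rw [hL, Real.sq_sqrt (by positivity)]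
  have hunit : (a / L) ^ 2 + (1 / L) ^ 2 = 1 := by
    field_simp
    linarith
  have hax : a / L = a * (1 / L) := by ring
  set y := 1 / L
  rw [hax] at hs0 ht0 hunit
  have e0 : z 0 - z' 0 = -(t 0 - s 0) - (r - r') * (a * y) := by linarith
  have e1 : z 1 - z' 1 = a * (t 0 - s 0) - (r - r') * y := by linarith
  have e2 : (z 0 - z' 0) ^ 2 + (z 1 - z' 1) ^ 2 =
      (1 + a ^ 2) * (t 0 - s 0) ^ 2 + (r - r') ^ 2 := by
    rw [e0, e1]
    linear_combination (r - r') ^ 2 * hunit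
  have ha2 : a ^ 2 ≤ 1 := by
    rw [← sq_abs]
    exact pow_le_one₀ (abs_nonneg a) ha
  by_contra! hcon
  have h5 : (t 0 - s 0) ^ 2 ≤ 1 := pow_le_one₀ (by linarith) (by linarith)
  nlinarith [mul_le_mul ha2 h5 (sq_nonneg _) zero_le_one,
    mul_nonneg (sub_nonneg.2 hr) (sub_nonneg.2 hr')]

/-- A hull edge between two points of the same disk degenerates. -/
lemma IsUpperContact.eq_of_mem_same_closedBall {S : Set Plane} {a r : ℝ} {z s t : Plane}
    (hr : 0 ≤ r)
    (hs : IsUpperContact S a s) (ht : IsUpperContact S a t) (hz : closedBall z r ⊆ S)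
    (hsz : s ∈ closedBall z r) (htz : t ∈ closedBall z r) : s = t := by
  obtain ⟨hs0, hs1⟩ := hs.eq_of_mem_closedBall hr hz hsz
  obtain ⟨ht0, ht1⟩ := ht.eq_of_mem_closedBall hr hz htz
  exact plane_ext (hs0.trans ht0.symm) (hs1.trans ht1.symm)

lemma abs_fst_sub_le {z q : Plane} {r : ℝ} (h : q ∈ closedBall z r) : |q 0 - z 0| ≤ r := by
  have := PiLp.dist_apply_le q z 0
  rw [Real.dist_eq] at this
  exact this.trans h

/-- It suffices to count edges traversed from left to right. -/
lemma ncard_edges_le {n : ℕ} {G : Fin n → Set Plane} {I : Set (Fin n)} {β : Type*}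
    (hG : ∀ i, IsClosed (G i)) (f : Plane × Plane → β) (T : Set β) (hT : T.Finite)
    (hf : ∀ e : Plane × Plane, IsEdgeOn G I e.1 e.2 → e.1 0 < e.2 0 → f e ∈ T)
    (hinj : InjOn f {e : Plane × Plane | IsEdgeOn G I e.1 e.2 ∧ e.1 0 < e.2 0}) :
    Set.ncard {e : Plane × Plane | IsEdgeOn G I e.1 e.2} ≤ 2 * T.ncard := by
  set R := {e : Plane × Plane | IsEdgeOn G I e.1 e.2 ∧ e.1 0 < e.2 0} with hR
  have hmaps : ∀ e ∈ R, f e ∈ T := fun e he => hf e he.1 he.2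
  have hRfin : R.Finite := Finite.of_injOn hmaps hinj hT
  have hcard : R.ncard ≤ T.ncard := ncard_le_ncard_of_injOn f hmaps hinj hT
  have hsub : {e : Plane × Plane | IsEdgeOn G I e.1 e.2} ⊆ R ∪ Prod.swap '' R := by
    rintro ⟨s, t⟩ h
    obtain ⟨a, -, hs, ht⟩ := IsEdgeOn.exists_isUpperContact hG h
    rcases lt_trichotomy (s 0) (t 0) with h1 | h1 | h1
    · exact Or.inl ⟨h, h1⟩
    · exact absurd (hs.eq_of_fst_eq ht h1) h.1
    · exact Or.inr ⟨(t, s), ⟨IsEdgeOn.symm h, h1⟩, rfl⟩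
  calc _ ≤ (R ∪ Prod.swap '' R).ncard :=
        ncard_le_ncard hsub (hRfin.union (hRfin.image _))
    _ ≤ R.ncard + (Prod.swap '' R).ncard := ncard_union_le _ _
    _ ≤ R.ncard + R.ncard := by exact Nat.add_le_add_left (ncard_image_le hRfin) _
    _ ≤ 2 * T.ncard := by omega

lemma ncard_edges_le_of_disjoint {n : ℕ} {k : ℝ} (hk : 1 ≤ k) {z : Fin n → Plane}
    {r : Fin n → ℝ} (hr : ∀ i, r i ∈ Set.Icc 1 k)
    (hd : ∀ i j, i ≠ j → Disjoint (closedBall (z i) (r i)) (closedBall (z j) (r j)))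
    {x₀ : ℝ} {I : Set (Fin n)} (hI : ∀ i ∈ I, |z i 0 - x₀| ≤ r i) :
    (Set.ncard {e : Plane × Plane |
      IsEdgeOn (fun i => closedBall (z i) (r i)) I e.1 e.2} : ℝ) ≤ 12 * k := by
  have hG : ∀ i, IsClosed (closedBall (z i) (r i)) := fun i => isClosed_closedBall
  have hlen : ∀ e : Plane × Plane, IsEdgeOn (fun i => closedBall (z i) (r i)) I e.1 e.2 →
      e.1 0 < e.2 0 → e.1 0 + 1 < e.2 0 := by
    rintro ⟨s, t⟩ h hst
    obtain ⟨a, ha, hs, ht⟩ := h.exists_isUpperContact hG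
    obtain ⟨hne, ⟨i, hi, hsi⟩, ⟨j, hj, htj⟩, -⟩ := h
    have hsub : ∀ i ∈ I, closedBall (z i) (r i) ⊆ ⋃ i ∈ I, closedBall (z i) (r i) :=
      fun i hi => subset_biUnion_of_mem (u := fun i => closedBall (z i) (r i)) hi
    have hsi' := (hG i).frontier_subset hsi.1
    have htj' := (hG j).frontier_subset htj.1
    refine one_lt_of_disjoint (hr i).1 (hr j).1 ha hs ht (hsub i hi) (hsub j hj) hsi' htj' hst
      (hd i j ?_)
    rintro rfl
    exact hne (hs.eq_of_mem_same_closedBall (by linarith [(hr i).1]) ht (hsub i hi) hsi' htj')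
  have hbound := ncard_edges_le (I := I) hG (fun e => ⌊e.1 0 - x₀⌋)
    (Set.Icc ⌊-(2 * k)⌋ ⌊2 * k⌋) (finite_Icc _ _) ?_ ?_
  · have hcard : (Set.Icc ⌊-(2 * k)⌋ ⌊2 * k⌋).ncard = (⌊2 * k⌋ + 1 - ⌊-(2 * k)⌋).toNat := by
      rw [← Finset.coe_Icc, ncard_coe_finset, Int.card_Icc]
    have hle : ((Set.Icc ⌊-(2 * k)⌋ ⌊2 * k⌋).ncard : ℝ) ≤ 6 * k := by
      rw [hcard]
      have h1 := Int.floor_le (2 * k)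
      have h2 := Int.lt_floor_add_one (-(2 * k))
      have h3 : 0 ≤ ⌊2 * k⌋ + 1 - ⌊-(2 * k)⌋ := by
        have : ⌊-(2 * k)⌋ ≤ ⌊2 * k⌋ := Int.floor_le_floor (by linarith)
        omega
      have h4 : (((⌊2 * k⌋ + 1 - ⌊-(2 * k)⌋).toNat : ℤ) : ℝ) = ⌊2 * k⌋ + 1 - ⌊-(2 * k)⌋ := by
        rw [Int.toNat_of_nonneg h3]
        push_cast
        ring
      rw [Int.cast_natCast] at h4
      linarith
    calc _ ≤ ((2 * (Set.Icc ⌊-(2 * k)⌋ ⌊2 * k⌋).ncard : ℕ) : ℝ) := by exact_mod_cast hbound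
      _ ≤ 12 * k := by
        push_cast
        linarith
  · rintro ⟨s, t⟩ ⟨-, ⟨i, hi, hs⟩, -⟩ -
    have h1 := abs_le.1 (abs_fst_sub_le ((hG i).frontier_subset hs.1))
    have h2 := abs_le.1 (hI i hi)
    have h3 := (hr i).2
    exact ⟨Int.floor_le_floor (by simp only; linarith),
      Int.floor_le_floor (by simp only; linarith)⟩
  · rintro ⟨s, t⟩ ⟨h, hst⟩ ⟨s', t'⟩ ⟨h', hst'⟩ hfl
    have hl := hlen _ h hst
    have hl' := hlen _ h' hst'
    have habs := abs_lt.1 (Int.abs_sub_lt_one_of_floor_eq_floor hfl)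
    simp only at h h' hst hst' hl hl' habs
    have h0 : s 0 = s' 0 := by
      rcases lt_trichotomy (s 0) (s' 0) with h1 | h1 | h1
      · linarith [h.not_between_s15 hG h' h1]
      · exact h1
      · linarith [h'.not_between_s15 hG h h1]
    obtain ⟨rfl, rfl⟩ := h.eq_of_fst_eq hG h' hst hst' h0
    rfl

/-- The center of a unit disk touching the hull is extreme among the centers. -/
lemma IsUpperContact.center_le {n : ℕ} {z : Fin n → Plane} {I : Set (Fin n)} {a : ℝ} {s : Plane}
    (hs : IsUpperContact (⋃ i ∈ I, closedBall (z i) 1) a s) {i j : Fin n} (hj : j ∈ I)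
    (hsi : s ∈ closedBall (z i) 1) : z j 1 + a * z j 0 ≤ z i 1 + a * z i 0 := by
  have h := hs.2 (z j + (s - z i)) (mem_biUnion hj (by
    simpa [mem_closedBall, dist_eq_norm] using hsi))
  simp only [PiLp.add_apply, PiLp.sub_apply] at h
  linarith

lemma ncard_touching_le {n : ℕ} {k : ℝ} {z : Fin n → Plane}
    (hply : ∀ q : Plane, (Set.ncard {i : Fin n | q ∈ closedBall (z i) 1} : ℝ) ≤ k)
    {x₀ y₀ : ℝ} {T : Set (Fin n)}
    (hT : ∀ i ∈ T, |z i 0 - x₀| ≤ 1 ∧ |z i 1 - y₀| ≤ 2) :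
    (T.ncard : ℝ) ≤ 15 * k := by
  let B : Finset (ℤ × ℤ) := Finset.Icc (-1) 1 ×ˢ Finset.Icc (-2) 2
  let D : ℤ × ℤ → Set (Fin n) :=
    fun g => {i | (!₂[x₀ + g.1, y₀ + g.2] : Plane) ∈ closedBall (z i) 1}
  have hround : ∀ (m : ℕ) (x : ℝ), |x| ≤ m → round x ∈ Finset.Icc (-(m : ℤ)) m := by
    intro m x hx
    rw [abs_le] at hx
    have h := abs_le.1 (abs_sub_round x)
    have h1 : (-(m : ℤ) - 1 : ℝ) < round x := by push_cast; linarith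
    have h2 : (round x : ℝ) < (m : ℤ) + 1 := by push_cast; linarith
    rw [Finset.mem_Icc]
    constructor
    · have : (-(m : ℤ) - 1 : ℤ) < round x := by exact_mod_cast h1
      omega
    · have : round x < (m : ℤ) + 1 := by exact_mod_cast h2
      omega
  have hcover : T ⊆ ⋃ g ∈ B, D g := by
    intro i hi
    obtain ⟨h0, h1⟩ := hT i hi
    refine mem_biUnion (x := (round (z i 0 - x₀), round (z i 1 - y₀))) ?_ ?_
    · exact Finset.mem_product.2 ⟨by simpa using hround 1 _ (by simpa using h0),
        by simpa using hround 2 _ (by simpa using h1)⟩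
    · refine (mem_closedBall_plane zero_le_one).2 ?_
      have e0 := abs_le.1 (abs_sub_round (z i 0 - x₀))
      have e1 := abs_le.1 (abs_sub_round (z i 1 - y₀))
      simp only [Matrix.cons_val_zero, Matrix.cons_val_one]
      nlinarith
  have hcard : T.ncard ≤ ∑ g ∈ B, (D g).ncard :=
    (ncard_le_ncard hcover (toFinite _)).trans (Finset.set_ncard_biUnion_le _ _)
  calc (T.ncard : ℝ) ≤ ∑ g ∈ B, ((D g).ncard : ℝ) := by exact_mod_cast hcard
    _ ≤ ∑ _g ∈ B, k := Finset.sum_le_sum fun g _ => hply _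
    _ = 15 * k := by
      rw [Finset.sum_const, nsmul_eq_mul]
      congr 1

lemma ncard_edges_le_of_ply {n : ℕ} {k : ℝ} {z : Fin n → Plane}
    (hply : ∀ q : Plane, (Set.ncard {i : Fin n | q ∈ closedBall (z i) 1} : ℝ) ≤ k)
    {x₀ : ℝ} {I : Set (Fin n)} (hI : ∀ i ∈ I, |z i 0 - x₀| ≤ 1) :
    (Set.ncard {e : Plane × Plane |
      IsEdgeOn (fun i => closedBall (z i) 1) I e.1 e.2} : ℝ) ≤ 30 * k := by
  have hG : ∀ i, IsClosed (closedBall (z i) 1) := fun i => isClosed_closedBall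
  have hsub : ∀ i ∈ I, closedBall (z i) 1 ⊆ ⋃ i ∈ I, closedBall (z i) 1 :=
    fun i hi => subset_biUnion_of_mem (u := fun i => closedBall (z i) 1) hi
  have hex : ∀ e : Plane × Plane, ∃ i : Option (Fin n),
      IsEdgeOn (fun i => closedBall (z i) 1) I e.1 e.2 →
        ∃ j ∈ I, i = some j ∧ e.1 ∈ closedBall (z j) 1 := by
    intro e
    by_cases h : IsEdgeOn (fun i => closedBall (z i) 1) I e.1 e.2
    · obtain ⟨j, hj, hs⟩ := h.2.1
      exact ⟨some j, fun _ => ⟨j, hj, rfl, (hG j).frontier_subset hs.1⟩⟩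
    · exact ⟨none, fun h' => absurd h' h⟩
  choose f hf using hex
  let T : Set (Fin n) := {i | i ∈ I ∧ ∃ a s, |a| ≤ 1 ∧ s ∈ closedBall (z i) 1 ∧
    IsUpperContact (⋃ i ∈ I, closedBall (z i) 1) a s}
  have hT : (T.ncard : ℝ) ≤ 15 * k := by
    rcases T.eq_empty_or_nonempty with h | ⟨i₀, hi₀, a₀, s₀, ha₀, hs₀, htop₀⟩
    · rw [h]
      have := (Nat.cast_nonneg _).trans (hply 0)
      simpa using this
    · refine ncard_touching_le (y₀ := z i₀ 1) hply (x₀ := x₀) ?_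
      rintro i ⟨hi, a, s, ha, hs, htop⟩
      refine ⟨hI i hi, ?_⟩
      have h1 := htop.center_le hi₀ hs
      have h2 := htop₀.center_le hi hs₀
      have hdx : |z i 0 - z i₀ 0| ≤ 2 := by
        have e1 := abs_le.1 (hI i hi)
        have e2 := abs_le.1 (hI i₀ hi₀)
        exact abs_le.2 ⟨by linarith, by linarith⟩
      have hmul : ∀ b : ℝ, |b| ≤ 1 → |b * (z i 0 - z i₀ 0)| ≤ 2 := by
        intro b hb
        rw [abs_mul]
        nlinarith [abs_nonneg b, abs_nonneg (z i 0 - z i₀ 0)]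
      have e1 := abs_le.1 (hmul a ha)
      have e2 := abs_le.1 (hmul a₀ ha₀)
      exact abs_le.2 ⟨by linarith, by linarith⟩
  have hbound := ncard_edges_le (I := I) hG f (some '' T) (toFinite _) ?_ ?_
  · have himg : (some '' T).ncard ≤ T.ncard := ncard_image_le (toFinite _)
    calc _ ≤ ((2 * T.ncard : ℕ) : ℝ) := by exact_mod_cast hbound.trans (by omega)
      _ ≤ 30 * k := by
        push_cast
        linarith
  · rintro e h -
    obtain ⟨j, hj, hfj, hs⟩ := hf e h
    obtain ⟨a, ha, htop, -⟩ := h.exists_isUpperContact hG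
    exact ⟨j, ⟨hj, a, e.1, ha, hs, htop⟩, hfj.symm⟩
  · have hslope : ∀ {s t s' : Plane} {a b : ℝ} {i : Fin n}, i ∈ I →
        IsEdgeOn (fun i => closedBall (z i) 1) I s t → s 0 < t 0 →
        IsUpperContact (⋃ i ∈ I, closedBall (z i) 1) a s →
        IsUpperContact (⋃ i ∈ I, closedBall (z i) 1) a t →
        IsUpperContact (⋃ i ∈ I, closedBall (z i) 1) b s' →
        s ∈ closedBall (z i) 1 → s' ∈ closedBall (z i) 1 → b ≤ a := by
      intro s t s' a b i hi h hst hs ht hs' hsi hsi'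
      obtain ⟨-, -, ⟨j, hj, htj⟩, -⟩ := h
      have htj' := (hG j).frontier_subset htj.1
      obtain ⟨hs0, hs1⟩ := hs.eq_of_mem_closedBall zero_le_one (hsub i hi) hsi
      obtain ⟨ht0, ht1⟩ := ht.eq_of_mem_closedBall zero_le_one (hsub j hj) htj'
      have hc := hs'.center_le hj hsi'
      have hline : t 1 - s 1 = -a * (t 0 - s 0) := by
        linarith [hs.2 t ht.1, ht.2 s hs.1]
      have e0 : z j 0 - z i 0 = t 0 - s 0 := by linarith
      have e1 : z j 1 - z i 1 = t 1 - s 1 := by linarith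
      have : b * (t 0 - s 0) ≤ a * (t 0 - s 0) := by
        rw [hline] at e1
        rw [← e0] at e1 ⊢
        linarith
      exact le_of_mul_le_mul_right this (by linarith)
    rintro ⟨s, t⟩ ⟨h, hst⟩ ⟨s', t'⟩ ⟨h', hst'⟩ heq
    obtain ⟨i, hi, hfi, hsi⟩ := hf _ h
    obtain ⟨i', hi', hfi', hsi'⟩ := hf _ h'
    obtain rfl : i = i' := Option.some_injective _ (hfi.symm.trans (heq.trans hfi'))
    obtain ⟨a, -, hs, ht⟩ := h.exists_isUpperContact hG
    obtain ⟨b, -, hs', ht'⟩ := h'.exists_isUpperContact hG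
    obtain rfl : a = b := le_antisymm (hslope hi h' hst' hs' ht' hs hsi' hsi)
      (hslope hi h hst hs ht hs' hsi hsi')
    have hss : s = s' := hs.eq_of_mem_same_closedBall zero_le_one hs' (hsub i hi) hsi hsi'
    obtain ⟨rfl, rfl⟩ := h.eq_of_fst_eq hG h' hst hst' (congrArg (fun p : Plane => p 0) hss)
    rfl

/-- for disks stabbed by a vertical line, the upper quarter outer convex
hull has at most c·k edges, for disjoint disks with radii in [1, k] or unit disks of
ply at most k. -/
theorem hull_complexity_line :
    ∃ c : ℝ, 0 < c ∧
      ∀ (k : ℝ), 1 ≤ k →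
      ∀ (n : ℕ) (z : Fin n → Plane) (r : Fin n → ℝ),
        (((∀ i, r i ∈ Set.Icc 1 k) ∧
          (∀ i j, i ≠ j →
            Disjoint (Metric.closedBall (z i) (r i)) (Metric.closedBall (z j) (r j)))) ∨
         ((∀ i, r i = 1) ∧
          (∀ q : Plane,
            (Set.ncard {i : Fin n | q ∈ Metric.closedBall (z i) (r i)} : ℝ) ≤ k))) →
      ∀ (x₀ : ℝ) (I : Set (Fin n)),
        I = {i | (Metric.closedBall (z i) (r i) ∩ {q : Plane | q 0 = x₀}).Nonempty} →
        (Set.ncard {e : Plane × Plane |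
          IsEdgeOn (fun i => Metric.closedBall (z i) (r i)) I e.1 e.2} : ℝ) ≤ c * k := by
  refine ⟨30, by norm_num, ?_⟩
  rintro k hk n z r hF x₀ I rfl
  have hI : ∀ i ∈ {i | (closedBall (z i) (r i) ∩ {q : Plane | q 0 = x₀}).Nonempty},
      |z i 0 - x₀| ≤ r i := by
    rintro i ⟨q, hq, rfl⟩
    rw [abs_sub_comm]
    exact abs_fst_sub_le hq
  rcases hF with ⟨hr, hd⟩ | ⟨hr, hply⟩
  · exact (ncard_edges_le_of_disjoint hk hr hd hI).trans (by linarith)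
  · obtain rfl : r = fun _ => 1 := funext hr
    exact ncard_edges_le_of_ply hply hI
end
end
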